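/- For 0<q<p≤1, n∈ℕ with n≥1, and x≥0, the (p,q)-Baskakov operator reproduces the identity function: B_{n,p,q}(t;x) = x, i.e. Σ_{k=0}^∞ [n+k−1 choose k]_{p,q} p^{k+n(n−1)/2} q^{k(k−1)/2} (x^k/(1⊕x)^{n+k}_{p,q}) · (p^{n−1}[k]_{p,q}/(q^{k−1}[n]_{p,q})) = x. -/

import Mathlib

open Real Set Filter

/-- The (p,q)-integer [n]_{p,q} = (p^n - q^n)/(p - q). -/
noncomputable def pqInt (p q : ℝ) (n : ℕ) : ℝ := (p ^ n - q ^ n) / (p - q)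

/-- The (p,q)-factorial [n]_{p,q}! . -/
noncomputable def pqFact (p q : ℝ) : ℕ → ℝ
  | 0 => 1
  | n + 1 => pqInt p q (n + 1) * pqFact p q n

/-- The (p,q)-binomial coefficient. -/
noncomputable def pqChoose (p q : ℝ) (n k : ℕ) : ℝ :=
  pqFact p q n / (pqFact p q k * pqFact p q (n - k))

/-- (1 ⊕ x)^n_{p,q} = ∏_{j=0}^{n-1} (p^j + q^j x). -/
noncomputable def pqOnePlusPow (p q x : ℝ) (n : ℕ) : ℝ :=
  ∏ j ∈ Finset.range n, (p ^ j + q ^ j * x)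

/-- The (p,q)-Baskakov operator B_{n,p,q}(f;x). -/
noncomputable def baskakov (p q : ℝ) (n : ℕ) (f : ℝ → ℝ) (x : ℝ) : ℝ :=
  ∑' k : ℕ, pqChoose p q (n + k - 1) k * p ^ (k + n * (n - 1) / 2) *
    q ^ (k * (k - 1) / 2) * (x ^ k / pqOnePlusPow p q x (n + k)) *
    f (p ^ (n - 1) * pqInt p q k / (q ^ (k - 1) * pqInt p q n))

/-- The function r_n(x) used in the King-type modification. -/
noncomputable def rn (p q : ℝ) (n : ℕ) (x : ℝ) : ℝ :=
  (-(p ^ (n - 1)) +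
      Real.sqrt (p ^ (2 * n - 2) + 4 * pqInt p q n * (pqInt p q n + p ^ n / q) * x ^ 2)) /
    (2 * (pqInt p q n + p ^ n / q))

/-- The King-type (p,q)-Baskakov operator B*_{n,p,q}(f;x) = B_{n,p,q}(f; r_n(x)). -/
noncomputable def kingBaskakov (p q : ℝ) (n : ℕ) (f : ℝ → ℝ) (x : ℝ) : ℝ :=
  baskakov p q n f (rn p q n x)

theorem pqInt_zero (p q : ℝ) : pqInt p q 0 = 0 := by simp [pqInt]

theorem pqInt_add {p q : ℝ} (hqp : q < p) (m k : ℕ) :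
    pqInt p q (m + k) = pqInt p q m * p ^ k + q ^ m * pqInt p q k := by
  have : p - q ≠ 0 := (sub_pos.2 hqp).ne'
  unfold pqInt
  field_simp
  ring

theorem pqInt_succ_pos {p q : ℝ} (hq : 0 < q) (hqp : q < p) (n : ℕ) : 0 < pqInt p q (n + 1) :=
  div_pos (sub_pos.2 (pow_lt_pow_left₀ hqp hq.le n.succ_ne_zero)) (sub_pos.2 hqp)

theorem pqInt_nonneg {p q : ℝ} (hq : 0 < q) (hqp : q < p) (n : ℕ) : 0 ≤ pqInt p q n :=
  div_nonneg (sub_nonneg.2 (pow_le_pow_left₀ hq.le hqp.le n)) (sub_pos.2 hqp).le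

theorem pqInt_le {p q : ℝ} (hq : 0 < q) (hqp : q < p) (n : ℕ) :
    pqInt p q n ≤ p ^ n / (p - q) := by
  have := sub_pos.2 hqp
  unfold pqInt
  gcongr
  linarith [pow_pos hq n]

theorem pqFact_pos {p q : ℝ} (hq : 0 < q) (hqp : q < p) (n : ℕ) : 0 < pqFact p q n := by
  induction n with
  | zero => simp [pqFact]
  | succ n ih => exact mul_pos (pqInt_succ_pos hq hqp n) ih

theorem pqOnePlusPow_factor_pos {p q x : ℝ} (hq : 0 < q) (hqp : q < p) (hx : 0 ≤ x) (n : ℕ) :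
    0 < p ^ n + q ^ n * x := by
  have := hq.trans hqp
  positivity

theorem pqOnePlusPow_pos {p q x : ℝ} (hq : 0 < q) (hqp : q < p) (hx : 0 ≤ x) (n : ℕ) :
    0 < pqOnePlusPow p q x n :=
  Finset.prod_pos fun j _ => pqOnePlusPow_factor_pos hq hqp hx j

theorem pqOnePlusPow_succ (p q x : ℝ) (n : ℕ) :
    pqOnePlusPow p q x (n + 1) = pqOnePlusPow p q x n * (p ^ n + q ^ n * x) :=
  Finset.prod_range_succ _ _

theorem pqChoose_add_left (p q : ℝ) (m k : ℕ) :
    pqChoose p q (m + k) k = pqFact p q (m + k) / (pqFact p q k * pqFact p q m) := by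
  rw [pqChoose, Nat.add_sub_cancel]

/-- The weights of the (p,q)-Baskakov operator of order `m + 1`. -/
noncomputable def baskakovWeight (p q x : ℝ) (m k : ℕ) : ℝ :=
  pqChoose p q (m + k) k * p ^ (k + (m + 1) * m / 2) * q ^ (k * (k - 1) / 2) *
    (x ^ k / pqOnePlusPow p q x (m + k + 1))

theorem baskakovWeight_nonneg {p q x : ℝ} (hq : 0 < q) (hqp : q < p) (hx : 0 ≤ x) (m k : ℕ) :
    0 ≤ baskakovWeight p q x m k := by
  have := hq.trans hqp
  have := pqFact_pos hq hqp (m + k)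
  have := pqFact_pos hq hqp m
  have := pqFact_pos hq hqp k
  have := pqOnePlusPow_pos hq hqp hx (m + k + 1)
  rw [baskakovWeight, pqChoose_add_left]
  positivity

theorem baskakovWeight_succ_left {p q x : ℝ} (hq : 0 < q) (hqp : q < p) (hx : 0 ≤ x) (m k : ℕ) :
    baskakovWeight p q x (m + 1) k = baskakovWeight p q x m k *
      (pqInt p q (m + 1 + k) * p ^ (m + 1) /
        (pqInt p q (m + 1) * (p ^ (m + 1 + k) + q ^ (m + 1 + k) * x))) := by
  have := (pqFact_pos hq hqp m).ne'
  have := (pqFact_pos hq hqp k).ne'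
  have := (pqInt_succ_pos hq hqp m).ne'
  have := (pqOnePlusPow_pos hq hqp hx (m + k + 1)).ne'
  have hD := (pqOnePlusPow_factor_pos hq hqp hx (m + k + 1)).ne'
  have e : (m + 1 + 1) * (m + 1) / 2 = (m + 1) * m / 2 + (m + 1) := Nat.triangle_succ (m + 1)
  rw [baskakovWeight, baskakovWeight, pqChoose_add_left, pqChoose_add_left, e,
    show m + 1 + k = m + k + 1 by ring, pqOnePlusPow_succ p q x (m + k + 1), pqFact, pqFact]
  field_simp
  ring

theorem baskakovWeight_succ_right {p q x : ℝ} (hq : 0 < q) (hqp : q < p) (hx : 0 ≤ x) (m k : ℕ) :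
    baskakovWeight p q x m (k + 1) = baskakovWeight p q x m k *
      (pqInt p q (m + 1 + k) * p * q ^ k * x /
        (pqInt p q (k + 1) * (p ^ (m + 1 + k) + q ^ (m + 1 + k) * x))) := by
  have := (pqFact_pos hq hqp m).ne'
  have := (pqFact_pos hq hqp k).ne'
  have := (pqInt_succ_pos hq hqp k).ne'
  have := (pqOnePlusPow_pos hq hqp hx (m + k + 1)).ne'
  have hD := (pqOnePlusPow_factor_pos hq hqp hx (m + k + 1)).ne'
  rw [baskakovWeight, baskakovWeight, pqChoose_add_left, pqChoose_add_left, Nat.triangle_succ k,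
    show m + 1 + k = m + k + 1 by ring, show m + (k + 1) = m + k + 1 by ring,
    pqOnePlusPow_succ p q x (m + k + 1), pqFact, pqFact]
  field_simp
  ring

theorem baskakovWeight_zero_left {p q x : ℝ} (hq : 0 < q) (hqp : q < p) (k : ℕ) :
    baskakovWeight p q x 0 k =
      p ^ k * q ^ (k * (k - 1) / 2) * (x ^ k / pqOnePlusPow p q x (k + 1)) := by
  have := (pqFact_pos hq hqp k).ne'
  rw [baskakovWeight, pqChoose_add_left]
  simp [pqFact, this]

theorem hasSum_baskakovWeight_zero {p q x : ℝ} (hq : 0 < q) (hqp : q < p) (hx : 0 ≤ x) :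
    HasSum (baskakovWeight p q x 0) 1 := by
  have hp := hq.trans hqp
  let U : ℕ → ℝ := fun k => q ^ (k * (k - 1) / 2) * (x ^ k / pqOnePlusPow p q x k)
  have hU (k : ℕ) : 0 ≤ U k := by
    have := pqOnePlusPow_pos hq hqp hx k
    positivity
  have hsum (N : ℕ) : ∑ k ∈ Finset.range N, baskakovWeight p q x 0 k = 1 - U N := by
    induction N with
    | zero => simp [U, pqOnePlusPow]
    | succ k ih =>
      have := (pqOnePlusPow_pos hq hqp hx k).ne'
      have := (pqOnePlusPow_factor_pos hq hqp hx k).ne'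
      rw [Finset.sum_range_succ, ih, baskakovWeight_zero_left hq hqp]
      simp only [U]
      rw [Nat.triangle_succ k, pqOnePlusPow_succ]
      field_simp
      ring
  have hnonneg := baskakovWeight_nonneg hq hqp hx 0
  have hsummable : Summable (baskakovWeight p q x 0) :=
    summable_of_sum_range_le (c := 1) hnonneg fun N => by rw [hsum]; linarith [hU N]
  have hle (k : ℕ) : U k ≤ (1 + x) * baskakovWeight p q x 0 k := by
    have hP := pqOnePlusPow_pos hq hqp hx k
    have hD := pqOnePlusPow_factor_pos hq hqp hx k
    have hpq : q ^ k ≤ p ^ k := pow_le_pow_left₀ hq.le hqp.le k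
    have h1 : 1 ≤ (1 + x) * p ^ k / (p ^ k + q ^ k * x) := by
      rw [one_le_div hD]
      nlinarith
    calc U k ≤ U k * ((1 + x) * p ^ k / (p ^ k + q ^ k * x)) := le_mul_of_one_le_right (hU k) h1
      _ = (1 + x) * baskakovWeight p q x 0 k := by
        rw [baskakovWeight_zero_left hq hqp, pqOnePlusPow_succ]
        simp only [U]
        field_simp
  have hU0 : Tendsto U atTop (nhds 0) :=
    squeeze_zero hU hle (by simpa using hsummable.tendsto_atTop_zero.const_mul (1 + x))
  rw [hasSum_iff_tendsto_nat_of_nonneg hnonneg]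
  simp_rw [hsum]
  simpa using hU0.const_sub 1

theorem HasSum.baskakovWeight_succ {p q x s : ℝ} (hq : 0 < q) (hqp : q < p) (hx : 0 ≤ x) {m : ℕ}
    (h : HasSum (baskakovWeight p q x m) s) : HasSum (baskakovWeight p q x (m + 1)) s := by
  have hp := hq.trans hqp
  have hM := pqInt_succ_pos hq hqp m
  let V : ℕ → ℝ := fun k =>
    baskakovWeight p q x m k * (q ^ (m + 1) * pqInt p q k / (pqInt p q (m + 1) * p ^ k))
  have hV (k : ℕ) : 0 ≤ V k := by
    have := baskakovWeight_nonneg hq hqp hx m k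
    have := pqInt_nonneg hq hqp k
    positivity
  have hsum (N : ℕ) : ∑ k ∈ Finset.range N, baskakovWeight p q x (m + 1) k =
      ∑ k ∈ Finset.range N, baskakovWeight p q x m k - V N := by
    induction N with
    | zero => simp [V, pqInt_zero]
    | succ k ih =>
      have := (pqOnePlusPow_factor_pos hq hqp hx (m + 1 + k)).ne'
      have := (pqInt_succ_pos hq hqp k).ne'
      rw [Finset.sum_range_succ, ih, Finset.sum_range_succ, baskakovWeight_succ_left hq hqp hx]
      simp only [V]
      rw [baskakovWeight_succ_right hq hqp hx, pqInt_add hqp (m + 1) k]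
      field_simp
      ring
  have hle (k : ℕ) :
      V k ≤ baskakovWeight p q x m k * (q ^ (m + 1) / (pqInt p q (m + 1) * (p - q))) := by
    have hpq := sub_pos.2 hqp
    refine mul_le_mul_of_nonneg_left ?_ (baskakovWeight_nonneg hq hqp hx m k)
    calc q ^ (m + 1) * pqInt p q k / (pqInt p q (m + 1) * p ^ k)
        ≤ q ^ (m + 1) * (p ^ k / (p - q)) / (pqInt p q (m + 1) * p ^ k) := by
          gcongr
          exact pqInt_le hq hqp k
      _ = q ^ (m + 1) / (pqInt p q (m + 1) * (p - q)) := by field_simp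
  have hV0 : Tendsto V atTop (nhds 0) :=
    squeeze_zero hV hle (by simpa using h.summable.tendsto_atTop_zero.mul_const _)
  rw [hasSum_iff_tendsto_nat_of_nonneg (baskakovWeight_nonneg hq hqp hx (m + 1))]
  simp_rw [hsum]
  simpa using h.tendsto_sum_nat.sub hV0

theorem hasSum_baskakovWeight {p q x : ℝ} (hq : 0 < q) (hqp : q < p) (hx : 0 ≤ x) (m : ℕ) :
    HasSum (baskakovWeight p q x m) 1 := by
  induction m with
  | zero => exact hasSum_baskakovWeight_zero hq hqp hx
  | succ m ih => exact ih.baskakovWeight_succ hq hqp hx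

theorem baskakov_id (p q : ℝ) (n : ℕ) (x : ℝ)
    (hq : 0 < q) (hqp : q < p) (hp : p ≤ 1) (hn : 1 ≤ n) (hx : 0 ≤ x) :
    baskakov p q n (fun t => t) x = x := by
  obtain ⟨m, rfl⟩ : ∃ m, n = m + 1 := ⟨n - 1, by omega⟩
  refine HasSum.tsum_eq ?_
  rw [← hasSum_nat_add_iff' 1]
  have h := (hasSum_baskakovWeight hq hqp hx (m + 1)).mul_left x
  convert h using 1
  · rfl
  · funext k
    have := (pqFact_pos hq hqp m).ne'
    have := (pqFact_pos hq hqp k).ne'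
    have := (pqInt_succ_pos hq hqp m).ne'
    have := (pqInt_succ_pos hq hqp k).ne'
    have := (pqOnePlusPow_pos hq hqp hx (m + 1 + k + 1)).ne'
    have e : (m + 1 + 1) * (m + 1) / 2 = (m + 1) * m / 2 + (m + 1) := Nat.triangle_succ (m + 1)
    rw [baskakovWeight, pqChoose_add_left, e, Nat.triangle_succ k,
      show m + 1 + (k + 1) - 1 = m + (k + 1) by omega, pqChoose_add_left,
      show m + (k + 1) = m + 1 + k by ring, show m + 1 + (k + 1) = m + 1 + k + 1 by ring,
      pqFact, pqFact]
    simp only [Nat.add_sub_cancel]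
    field_simp
    ring
  · simp [pqInt_zero]
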